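/- arXiv:2010.04450 — 2 statements merged into one kernel-verified Lean document; each statement's English description precedes it below -/
import Mathlib

section
/- For every n ≥ 2, the orientation covering number of the complete graph K_n is the smallest positive integer k such that λ(k) ≥ n, where λ(k) is the number of maximal intersecting families of subsets of [k]. -/
open SimpleGraph

/-- `o` is an orientation of the simple graph `G`: every oriented pair is an edge of `G`,
and every edge `{x,y}` of `G` receives exactly one of the two directions. -/
def IsOrientation {V : Type*} (G : SimpleGraph V) (o : V → V → Prop) : Prop :=
  (∀ x y, o x y → G.Adj x y) ∧ ∀ x y, G.Adj x y → (o x y ↔ ¬ o y x)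

/-- The list of orientations `o 1, …, o k` of `G` is an orientation covering of `G`:
each `o i` is an orientation of `G`, and whenever `xy, xz ∈ E(G)` there is some `i`
in which both `xy` and `xz` are oriented away from `x`. -/
def IsOrientationCovering {V : Type*} (G : SimpleGraph V) {k : ℕ}
    (o : Fin k → V → V → Prop) : Prop :=
  (∀ i, IsOrientation G (o i)) ∧
    ∀ x y z, G.Adj x y → G.Adj x z → ∃ i, o i x y ∧ o i x z

/-- The orientation covering number `σ(G)`: the smallest positive `k` for which there
exist `k` orientations of `G` forming an orientation covering of `G`. -/
noncomputable def orCov {V : Type*} (G : SimpleGraph V) : ℕ :=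
  sInf {k : ℕ | 0 < k ∧ ∃ o : Fin k → V → V → Prop, IsOrientationCovering G o}

/-- A family `𝒜` of subsets of `[k]` is intersecting if any two of its members meet. -/
def IntersectingFam {k : ℕ} (𝒜 : Finset (Finset (Fin k))) : Prop :=
  ∀ S ∈ 𝒜, ∀ T ∈ 𝒜, (S ∩ T).Nonempty

/-- A family `𝒜` of subsets of `[k]` is maximal intersecting if it is intersecting and is
not properly contained in any intersecting family of subsets of `[k]`. -/
def MaxIntersectingFam {k : ℕ} (𝒜 : Finset (Finset (Fin k))) : Prop :=
  IntersectingFam 𝒜 ∧ ∀ ℬ : Finset (Finset (Fin k)), IntersectingFam ℬ → 𝒜 ⊆ ℬ → ℬ = 𝒜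

/-- `λ(k)`: the number of maximal intersecting families of subsets of `[k]`. -/
noncomputable def lambdaMI (k : ℕ) : ℕ :=
  Nat.card {𝒜 : Finset (Finset (Fin k)) // MaxIntersectingFam 𝒜}

namespace MaxIntersectingFam

variable {k : ℕ} {𝒜 ℬ : Finset (Finset (Fin k))} {S : Finset (Fin k)}

lemma mem_of_forall_inter (h𝒜 : MaxIntersectingFam 𝒜) (hS : S.Nonempty)
    (h : ∀ T ∈ 𝒜, (S ∩ T).Nonempty) : S ∈ 𝒜 := by
  have hins : IntersectingFam (insert S 𝒜) := by
    intro A hA B hB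
    rcases Finset.mem_insert.1 hA with rfl | hA' <;>
      rcases Finset.mem_insert.1 hB with rfl | hB'
    · simpa using hS
    · exact h B hB'
    · rw [Finset.inter_comm]; exact h A hA'
    · exact h𝒜.1 A hA' B hB'
  rw [← h𝒜.2 _ hins (Finset.subset_insert S 𝒜)]
  exact Finset.mem_insert_self S 𝒜

lemma compl_mem_of_notMem (h𝒜 : MaxIntersectingFam 𝒜) (hk : 0 < k) (hS : S ∉ 𝒜) : Sᶜ ∈ 𝒜 := by
  have : NeZero k := ⟨hk.ne'⟩
  have hself : ∀ T ∈ 𝒜, T.Nonempty := fun T hT => by simpa using h𝒜.1 T hT T hT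
  rcases S.eq_empty_or_nonempty with rfl | hne
  · exact h𝒜.mem_of_forall_inter (by simp) fun T hT => by simpa using hself T hT
  · obtain ⟨T, hT, hST⟩ : ∃ T ∈ 𝒜, ¬ (S ∩ T).Nonempty := by
      by_contra! h
      exact hS (h𝒜.mem_of_forall_inter hne h)
    have hsub : T ⊆ Sᶜ := fun x hx =>
      Finset.mem_compl.2 fun hxS => hST ⟨x, Finset.mem_inter.2 ⟨hxS, hx⟩⟩
    exact h𝒜.mem_of_forall_inter ((hself T hT).mono hsub) fun U hU =>
      (h𝒜.1 T hT U hU).mono (Finset.inter_subset_inter_right hsub)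

lemma compl_notMem (h𝒜 : MaxIntersectingFam 𝒜) (hS : S ∈ 𝒜) : Sᶜ ∉ 𝒜 := fun hSc => by
  simpa using h𝒜.1 S hS _ hSc

lemma exists_mem_compl_mem (h𝒜 : MaxIntersectingFam 𝒜) (hℬ : MaxIntersectingFam ℬ) (hk : 0 < k)
    (hne : 𝒜 ≠ ℬ) : ∃ S ∈ 𝒜, Sᶜ ∈ ℬ := by
  obtain ⟨S, hS, hSℬ⟩ := Finset.not_subset.1 fun hsub => hne (h𝒜.2 ℬ hℬ.1 hsub).symm
  exact ⟨S, hS, hℬ.compl_mem_of_notMem hk hSℬ⟩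

end MaxIntersectingFam

lemma IntersectingFam.exists_subset_maxIntersectingFam {k : ℕ} {𝒜 : Finset (Finset (Fin k))}
    (h : IntersectingFam 𝒜) : ∃ ℬ, 𝒜 ⊆ ℬ ∧ MaxIntersectingFam ℬ := by
  obtain ⟨ℬ, hle, hmax⟩ := (Set.toFinite {ℬ | IntersectingFam (k := k) ℬ}).exists_le_maximal h
  exact ⟨ℬ, hle, hmax.prop, fun 𝒞 h𝒞 hsub => (hmax.eq_of_le h𝒞 hsub).symm⟩

lemma maxIntersectingFam_star {k : ℕ} (x : Fin k) :
    MaxIntersectingFam (Finset.univ.filter fun S : Finset (Fin k) => x ∈ S) := by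
  refine ⟨fun S hS T hT => ⟨x, by simp_all⟩, fun ℬ hℬ hsub => ?_⟩
  refine (hsub.antisymm fun S hS => ?_).symm
  obtain ⟨y, hy⟩ := hℬ S hS {x} (hsub (by simp))
  simp only [Finset.mem_inter, Finset.mem_singleton] at hy
  simpa [← hy.2] using hy.1

lemma le_lambdaMI_iff_nonempty_embedding {n k : ℕ} :
    n ≤ lambdaMI k ↔
      Nonempty (Fin n ↪ {𝒜 : Finset (Finset (Fin k)) // MaxIntersectingFam 𝒜}) := by
  classical
  rw [lambdaMI, Nat.card_eq_fintype_card, Function.Embedding.nonempty_iff_card_le,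
    Fintype.card_fin]

lemma self_le_lambdaMI (k : ℕ) : k ≤ lambdaMI k := by
  refine le_lambdaMI_iff_nonempty_embedding.2 ⟨⟨fun x => ⟨_, maxIntersectingFam_star x⟩, ?_⟩⟩
  intro x y hxy
  have := congrArg (fun 𝒜 => ({y} : Finset (Fin k)) ∈ 𝒜.1) hxy
  simpa using this

lemma exists_isOrientationCovering_of_le_lambdaMI {n k : ℕ} (hk : 0 < k) (h : n ≤ lambdaMI k) :
    ∃ o : Fin k → Fin n → Fin n → Prop, IsOrientationCovering ⊤ o := by
  obtain ⟨f⟩ := le_lambdaMI_iff_nonempty_embedding.1 h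
  have hsep : ∀ x y : Fin n, x ≠ y → ∃ S ∈ (f x).1, Sᶜ ∈ (f y).1 := fun x y hxy =>
    (f x).2.exists_mem_compl_mem (f y).2 hk fun he => hxy (f.injective (Subtype.ext he))
  choose! S hS hSc using hsep
  let out (x y : Fin n) : Finset (Fin k) := if x < y then S x y else (S y x)ᶜ
  have hout : ∀ x y, x ≠ y → out x y ∈ (f x).1 := by
    intro x y hxy
    by_cases hlt : x < y
    · simpa [out, hlt] using hS x y hxy
    · simpa [out, hlt] using hSc y x hxy.symm
  have hcompl : ∀ x y, x ≠ y → out x y = (out y x)ᶜ := by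
    intro x y hxy
    rcases hxy.lt_or_gt with hlt | hlt <;> simp [out, hlt, hlt.not_gt]
  refine ⟨fun i x y => x ≠ y ∧ i ∈ out x y, fun i => ⟨fun x y hxy => hxy.1, ?_⟩, ?_⟩
  · intro x y hxy
    have hne : x ≠ y := hxy
    simp [hne, hne.symm, hcompl x y hne]
  · intro x y z hxy hxz
    obtain ⟨i, hi⟩ := (f x).2.1 _ (hout x y hxy) _ (hout x z hxz)
    rw [Finset.mem_inter] at hi
    exact ⟨i, ⟨hxy, hi.1⟩, hxz, hi.2⟩

lemma IsOrientationCovering.le_lambdaMI {n k : ℕ} {o : Fin k → Fin n → Fin n → Prop}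
    (ho : IsOrientationCovering ⊤ o) : n ≤ lambdaMI k := by
  classical
  let out (x y : Fin n) : Finset (Fin k) := Finset.univ.filter fun i => o i x y
  have hint (x : Fin n) : IntersectingFam ((Finset.univ.filter (x ≠ ·)).image (out x)) := by
    intro A hA B hB
    simp only [Finset.mem_image, Finset.mem_filter, Finset.mem_univ, true_and] at hA hB
    obtain ⟨y, hy, rfl⟩ := hA
    obtain ⟨z, hz, rfl⟩ := hB
    obtain ⟨i, hi⟩ := ho.2 x y z hy hz
    exact ⟨i, by simpa [out] using hi⟩
  choose F hsub hF using fun x => (hint x).exists_subset_maxIntersectingFam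
  have hmem : ∀ x y, x ≠ y → out x y ∈ F x := fun x y hxy =>
    hsub x (Finset.mem_image_of_mem _ (by simpa using hxy))
  refine le_lambdaMI_iff_nonempty_embedding.2 ⟨⟨fun x => ⟨F x, hF x⟩, fun x y hxy => ?_⟩⟩
  by_contra hne
  have hcompl : (out x y)ᶜ = out y x := by
    ext i
    simpa [out] using ((ho.1 i).2 y x (Ne.symm hne)).symm
  refine (hF x).compl_notMem (hmem x y hne) ?_
  rw [hcompl, show F x = F y from congrArg Subtype.val hxy]
  exact hmem y x (Ne.symm hne)

/-- For every `n ≥ 2`, `σ(K_n)` is the smallest positive integer `k` with `λ(k) ≥ n`. -/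
theorem orCov_completeGraph_isLeast_lambda_ge (n : ℕ) (hn : 2 ≤ n) :
    IsLeast {k : ℕ | 0 < k ∧ n ≤ lambdaMI k} (orCov (⊤ : SimpleGraph (Fin n))) := by
  have hset : {k : ℕ | 0 < k ∧ ∃ o : Fin k → Fin n → Fin n → Prop, IsOrientationCovering ⊤ o} =
      {k : ℕ | 0 < k ∧ n ≤ lambdaMI k} :=
    Set.ext fun k => and_congr_right fun hk =>
      ⟨fun ⟨_, ho⟩ => ho.le_lambdaMI, exists_isOrientationCovering_of_le_lambdaMI hk⟩
  rw [orCov, hset]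
  exact ⟨Nat.sInf_mem ⟨n, by lia, self_le_lambdaMI n⟩, fun k hk => Nat.sInf_le hk⟩
end

section
/- Let G be a finite graph with at least one edge and let k be a positive integer such that the number of maximal intersecting families of subsets of [k] is at least χ(G). Then σ(G) ≤ k, i.e. there exist k orientations of G forming an orientation covering. -/
open SimpleGraph

/-- A nonempty set outside a maximal intersecting family has its complement in the family. -/
theorem MaxIntersectingFam.compl_mem {k : ℕ} {𝒜 : Finset (Finset (Fin k))}
    (h𝒜 : MaxIntersectingFam 𝒜) {S : Finset (Fin k)} (hS : S.Nonempty) (hS𝒜 : S ∉ 𝒜) :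
    Sᶜ ∈ 𝒜 := by
  have mem_of_meets : ∀ R : Finset (Fin k), R.Nonempty → (∀ T ∈ 𝒜, (R ∩ T).Nonempty) → R ∈ 𝒜 := by
    intro R hR h
    rw [← h𝒜.2 (insert R 𝒜) ?_ (Finset.subset_insert _ _)]
    · exact Finset.mem_insert_self _ _
    · intro X hX Y hY
      rcases Finset.mem_insert.1 hX with rfl | hX' <;> rcases Finset.mem_insert.1 hY with rfl | hY'
      · simpa using hR
      · exact h Y hY'
      · rw [Finset.inter_comm]
        exact h X hX'
      · exact h𝒜.1 X hX' Y hY'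
  obtain ⟨T, hT, hST⟩ : ∃ T ∈ 𝒜, ¬(S ∩ T).Nonempty := by
    by_contra! h
    exact hS𝒜 (mem_of_meets S hS h)
  have hTS : T ⊆ Sᶜ := fun i hi => by
    rw [Finset.mem_compl]
    exact fun hiS => hST ⟨i, Finset.mem_inter.2 ⟨hiS, hi⟩⟩
  refine mem_of_meets Sᶜ ?_ fun R hR =>
    (h𝒜.1 T hT R hR).mono (Finset.inter_subset_inter_right hTS)
  exact ((h𝒜.1 T hT T hT).mono Finset.inter_subset_left).mono hTS

/-- Distinct maximal intersecting families are separated by a complementary pair. -/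
theorem MaxIntersectingFam.exists_mem_compl_mem_s8 {k : ℕ} {𝒜 ℬ : Finset (Finset (Fin k))}
    (h𝒜 : MaxIntersectingFam 𝒜) (hℬ : MaxIntersectingFam ℬ) (hne : 𝒜 ≠ ℬ) :
    ∃ S ∈ 𝒜, Sᶜ ∈ ℬ := by
  obtain ⟨S, hS, hSℬ⟩ := Finset.not_subset.1 fun h => hne (h𝒜.2 ℬ hℬ.1 h).symm
  exact ⟨S, hS, hℬ.compl_mem ((h𝒜.1 S hS S hS).mono Finset.inter_subset_left) hSℬ⟩

/-- The sets separating a sequence of distinct maximal intersecting families can be chosen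
so that swapping the two indices takes the complement. -/
theorem exists_separating_sets {n k : ℕ} (F : Fin n → Finset (Finset (Fin k)))
    (hF : ∀ a, MaxIntersectingFam (F a)) (hinj : Function.Injective F) :
    ∃ s : Fin n → Fin n → Finset (Fin k),
      ∀ a b, a ≠ b → s a b ∈ F a ∧ s b a = (s a b)ᶜ := by
  have h : ∀ a b, ∃ S, a ≠ b → S ∈ F a ∧ Sᶜ ∈ F b := fun a b => by
    by_cases hab : a = b
    · exact ⟨∅, fun h => absurd hab h⟩
    · obtain ⟨S, h⟩ := (hF a).exists_mem_compl_mem_s8 (hF b) (hinj.ne hab)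
      exact ⟨S, fun _ => h⟩
  choose g hg using h
  refine ⟨fun a b => if a < b then g a b else (g b a)ᶜ, fun a b hab => ?_⟩
  rcases lt_or_gt_of_ne hab with hlt | hlt
  · simp [hlt, hlt.not_gt, hg a b hab]
  · simp [hlt, hlt.not_gt, hg b a hab.symm]

theorem exists_isOrientationCovering_of_coloring {V : Type*} {G : SimpleGraph V} {n k : ℕ}
    (c : G.Coloring (Fin n)) (hn : n ≤ lambdaMI k) :
    ∃ o : Fin k → V → V → Prop, IsOrientationCovering G o := by
  let e := Finite.equivFin {𝒜 : Finset (Finset (Fin k)) // MaxIntersectingFam 𝒜}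
  obtain ⟨s, hs⟩ := exists_separating_sets (fun a : Fin n => (e.symm (Fin.castLE hn a)).1)
    (fun a => (e.symm (Fin.castLE hn a)).2)
    (Subtype.val_injective.comp (e.symm.injective.comp (Fin.castLE_injective hn)))
  refine ⟨fun i x y => G.Adj x y ∧ i ∈ s (c x) (c y),
    fun i => ⟨fun x y h => h.1, fun x y hxy => ?_⟩, fun x y z hxy hxz => ?_⟩
  · simp [hxy, hxy.symm, (hs _ _ (c.valid hxy)).2]
  · obtain ⟨i, hi⟩ := (e.symm (Fin.castLE hn (c x))).2.1 _ (hs _ _ (c.valid hxy)).1 _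
      (hs _ _ (c.valid hxz)).1
    rw [Finset.mem_inter] at hi
    exact ⟨i, ⟨hxy, hi.1⟩, ⟨hxz, hi.2⟩⟩

/-- If `k` is a positive integer with `λ(k) ≥ χ(G)`, then `σ(G) ≤ k`, i.e. there exist
`k` orientations of `G` forming an orientation covering. -/
theorem orCov_le_of_chromaticNumber_le_lambda
    {V : Type*} [Fintype V] (G : SimpleGraph V) (hG : ∃ u v, G.Adj u v)
    (n : ℕ) (hn : G.chromaticNumber = (n : ℕ∞))
    (k : ℕ) (hk : 0 < k) (hkn : n ≤ lambdaMI k) :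
    orCov G ≤ k ∧ ∃ o : Fin k → V → V → Prop, IsOrientationCovering G o := by
  obtain ⟨c⟩ := chromaticNumber_le_iff_colorable.1 hn.le
  have h := exists_isOrientationCovering_of_coloring c hkn
  exact ⟨Nat.sInf_le ⟨hk, h⟩, h⟩
end
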